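/- arXiv:1212.6720 — 3 statements merged into one kernel-verified Lean document; each statement's English description precedes it below -/
import Mathlib

section
/- Let i : (g_D, g_{D,−}, g_{D,+}) → (g, g₋, g₊) be a split embedding of finite-dimensional Manin triples over a field k of characteristic zero. Then m₊ := g₊ ∩ i(g_D)^⊥ is a Lie ideal of g₊ and m₋ := g₋ ∩ i(g_D)^⊥ is a Lie ideal of g₋; in particular g_± = m_± ⋊ i(g_{D,±}). -/
namespace ManinStmt

/-- A (finite-dimensional) Manin triple: a Lie algebra `g` with a nondegenerate
symmetric invariant bilinear form and two isotropic Lie subalgebras `plus`,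
`minus` with `g = minus ⊕ plus` as vector spaces. -/
structure ManinTriple (k g : Type*) [Field k] [LieRing g] [LieAlgebra k g] where
  form : g →ₗ[k] g →ₗ[k] k
  nondeg : ∀ x : g, (∀ y : g, form x y = 0) → x = 0
  symm : ∀ x y : g, form x y = form y x
  invariant : ∀ x y z : g, form ⁅x, y⁆ z = form x ⁅y, z⁆
  plus : LieSubalgebra k g
  minus : LieSubalgebra k g
  isotropic_plus : ∀ x ∈ plus, ∀ y ∈ plus, form x y = 0
  isotropic_minus : ∀ x ∈ minus, ∀ y ∈ minus, form x y = 0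
  compl : IsCompl minus.toSubmodule plus.toSubmodule

variable {k gD g : Type*} [Field k]
  [LieRing gD] [LieAlgebra k gD] [LieRing g] [LieAlgebra k g]

/-- An embedding of Manin triples: an injective, form-preserving Lie algebra
morphism mapping `plus` into `plus` and `minus` into `minus`. -/
structure IsManinEmbedding (TD : ManinTriple k gD) (T : ManinTriple k g)
    (i : gD →ₗ⁅k⁆ g) : Prop where
  inj : Function.Injective i
  form_eq : ∀ x y : gD, T.form (i x) (i y) = TD.form x y
  maps_plus : ∀ x ∈ TD.plus, i x ∈ T.plus
  maps_minus : ∀ x ∈ TD.minus, i x ∈ T.minus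

/-- The orthogonal complement of `i(gD)` in `g` with respect to the form of `T`. -/
def perpD (T : ManinTriple k g) (i : gD →ₗ⁅k⁆ g) : Submodule k g where
  carrier := {x | ∀ d : gD, T.form x (i d) = 0}
  add_mem' := fun {a b} ha hb d => by
    rw [map_add, LinearMap.add_apply, ha d, hb d, add_zero]
  zero_mem' := fun d => by simp
  smul_mem' := fun c x hx d => by
    rw [map_smul, LinearMap.smul_apply, hx d, smul_zero]

/-- `m₊ = g₊ ∩ i(gD)^⊥`. -/
def mPlus (T : ManinTriple k g) (i : gD →ₗ⁅k⁆ g) : Submodule k g :=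
  T.plus.toSubmodule ⊓ perpD T i

/-- `m₋ = g₋ ∩ i(gD)^⊥`. -/
def mMinus (T : ManinTriple k g) (i : gD →ₗ⁅k⁆ g) : Submodule k g :=
  T.minus.toSubmodule ⊓ perpD T i

/-- The embedding is split if `m₊` and `m₋` are Lie subalgebras of `g`. -/
def IsSplit (T : ManinTriple k g) (i : gD →ₗ⁅k⁆ g) : Prop :=
  (∀ x ∈ mPlus T i, ∀ y ∈ mPlus T i, ⁅x, y⁆ ∈ mPlus T i) ∧
  (∀ x ∈ mMinus T i, ∀ y ∈ mMinus T i, ⁅x, y⁆ ∈ mMinus T i)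


namespace ManinTriple

/-- The Manin triple with the roles of the two isotropic subalgebras exchanged. -/
def swap (T : ManinTriple k g) : ManinTriple k g where
  form := T.form
  nondeg := T.nondeg
  symm := T.symm
  invariant := T.invariant
  plus := T.minus
  minus := T.plus
  isotropic_plus := T.isotropic_minus
  isotropic_minus := T.isotropic_plus
  compl := T.compl.symm

/-- The isotropic subalgebra `plus` is its own orthogonal complement. -/
theorem mem_plus_of_forall_form_eq_zero (T : ManinTriple k g) {x : g}
    (hx : ∀ y ∈ T.plus, T.form x y = 0) : x ∈ T.plus := by
  have decomp (z : g) : ∃ a ∈ T.minus, ∃ b ∈ T.plus, a + b = z :=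
    Submodule.mem_sup.1 (T.compl.sup_eq_top.symm ▸ Submodule.mem_top : z ∈ _ ⊔ _)
  obtain ⟨a, ha, b, hb, rfl⟩ := decomp x
  have ha0 : a = 0 := by
    refine T.nondeg a fun y => ?_
    obtain ⟨c, hc, d, hd, rfl⟩ := decomp y
    have h := hx d hd
    rw [map_add, LinearMap.add_apply, T.isotropic_plus b hb d hd, add_zero] at h
    rw [map_add, T.isotropic_minus a ha c hc, h, add_zero]
  rwa [ha0, zero_add]

/-- Every linear functional is represented by the form. -/
theorem form_surjective [FiniteDimensional k g] (T : ManinTriple k g) :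
    Function.Surjective T.form := by
  have hinj : Function.Injective T.form :=
    (injective_iff_map_eq_zero T.form).2 fun x hx => T.nondeg x fun y => by simp [hx]
  exact (LinearMap.injective_iff_surjective_of_finrank_eq_finrank
    (Subspace.dual_finrank_eq (K := k) (V := g)).symm).1 hinj

end ManinTriple

theorem IsManinEmbedding.swap {TD : ManinTriple k gD} {T : ManinTriple k g} {i : gD →ₗ⁅k⁆ g}
    (hi : IsManinEmbedding TD T i) : IsManinEmbedding TD.swap T.swap i :=
  ⟨hi.inj, hi.form_eq, hi.maps_minus, hi.maps_plus⟩

theorem IsManinEmbedding.disjoint_mPlus {TD : ManinTriple k gD} {T : ManinTriple k g}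
    {i : gD →ₗ⁅k⁆ g} (hi : IsManinEmbedding TD T i) :
    Disjoint (mPlus T i) (TD.plus.toSubmodule.map i.toLinearMap) := by
  rw [Submodule.disjoint_def]
  rintro _ ⟨-, hx⟩ ⟨d, -, rfl⟩
  have hd : d = 0 := TD.nondeg d fun e => (hi.form_eq d e).symm.trans (hx e)
  simp [hd]

theorem IsManinEmbedding.mPlus_sup_map {TD : ManinTriple k gD} {T : ManinTriple k g}
    {i : gD →ₗ⁅k⁆ g} [FiniteDimensional k gD] (hi : IsManinEmbedding TD T i) :
    mPlus T i ⊔ TD.plus.toSubmodule.map i.toLinearMap = T.plus.toSubmodule := by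
  refine le_antisymm (sup_le inf_le_left ?_) fun x hx => ?_
  · rintro _ ⟨d, hd, rfl⟩
    exact hi.maps_plus d hd
  · obtain ⟨e, he⟩ := TD.form_surjective (T.form x ∘ₗ i.toLinearMap)
    have he' (d : gD) : TD.form e d = T.form x (i d) := LinearMap.congr_fun he d
    have heP : e ∈ TD.plus := TD.mem_plus_of_forall_form_eq_zero fun d hd => by
      rw [he', T.isotropic_plus x hx _ (hi.maps_plus d hd)]
    refine Submodule.mem_sup.2 ⟨x - i e, ⟨T.plus.sub_mem hx (hi.maps_plus e heP), fun d => ?_⟩,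
      i e, ⟨e, heP, rfl⟩, sub_add_cancel _ _⟩
    rw [map_sub, LinearMap.sub_apply, hi.form_eq, he', sub_self]

theorem lie_mem_perpD (T : ManinTriple k g) (i : gD →ₗ⁅k⁆ g) (d : gD) {y : g}
    (hy : y ∈ perpD T i) : ⁅i d, y⁆ ∈ perpD T i := fun e => by
  rw [← lie_skew, map_neg, LinearMap.neg_apply, T.invariant, ← LieHom.map_lie, hy, neg_zero]

theorem IsManinEmbedding.lie_mem_mPlus {TD : ManinTriple k gD} {T : ManinTriple k g}
    {i : gD →ₗ⁅k⁆ g} [FiniteDimensional k gD] (hi : IsManinEmbedding TD T i)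
    (hsub : ∀ x ∈ mPlus T i, ∀ y ∈ mPlus T i, ⁅x, y⁆ ∈ mPlus T i) :
    ∀ x ∈ T.plus, ∀ y ∈ mPlus T i, ⁅x, y⁆ ∈ mPlus T i := by
  intro x hx y hy
  obtain ⟨m, hm, _, ⟨d, hd, rfl⟩, rfl⟩ :=
    Submodule.mem_sup.1 (hi.mPlus_sup_map.ge hx)
  rw [add_lie]
  exact add_mem (hsub m hm y hy)
    ⟨T.plus.lie_mem (hi.maps_plus d hd) hy.1, lie_mem_perpD T i d hy.2⟩

/-- for a split embedding of Manin triples, `m₊` is a Lie ideal of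
`g₊` and `m₋` is a Lie ideal of `g₋`; in particular `g_± = m_± ⋊ i(g_{D,±})`. -/
theorem mPlus_mMinus_ideals [CharZero k]
    [FiniteDimensional k gD] [FiniteDimensional k g]
    (TD : ManinTriple k gD) (T : ManinTriple k g)
    (i : gD →ₗ⁅k⁆ g) (hi : IsManinEmbedding TD T i) (hsplit : IsSplit T i) :
    (∀ x ∈ T.plus, ∀ y ∈ mPlus T i, ⁅x, y⁆ ∈ mPlus T i) ∧
    (∀ x ∈ T.minus, ∀ y ∈ mMinus T i, ⁅x, y⁆ ∈ mMinus T i) ∧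
    Disjoint (mPlus T i) (TD.plus.toSubmodule.map i.toLinearMap) ∧
    mPlus T i ⊔ TD.plus.toSubmodule.map i.toLinearMap = T.plus.toSubmodule ∧
    Disjoint (mMinus T i) (TD.minus.toSubmodule.map i.toLinearMap) ∧
    mMinus T i ⊔ TD.minus.toSubmodule.map i.toLinearMap = T.minus.toSubmodule := by
  exact ⟨hi.lie_mem_mPlus hsplit.1, hi.swap.lie_mem_mPlus hsplit.2, hi.disjoint_mPlus,
    hi.mPlus_sup_map, hi.swap.disjoint_mPlus, hi.swap.mPlus_sup_map⟩

end ManinStmt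
end

section
/- Let (h, (α_i)_{i∈I}, (h_i)_{i∈I}) be a realization of an n×n matrix A over a field k of characteristic zero. Let J′, J″ ⊆ I be nonempty subsets with nonempty intersection, and suppose subspaces h_{J′}, h_{J″}, h_{J′∩J″} of h are chosen (each of the form h_J = h'_J ⊕ h''_J with h''_J a complement of h'_J + t_J in h) satisfying h_{J′∩J″} ⊆ h_{J′} ∩ h_{J″}. Then corank(A_{J′∩J″}) ≤ corank(A_{J′}) + corank(A_{J″}), where corank(A_J) := |J| − rank(A_J). In particular, if corank(A_{J′}) = corank(A_{J″}) = 0 then corank(A_{J′∩J″}) = 0. -/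
namespace RealizationStmt

variable {k : Type*} [Field k] [CharZero k]
variable {I : Type*} [Fintype I] [DecidableEq I]
variable {h : Type*} [AddCommGroup h] [Module k h]

/-- `(h, α, Hv)` is a realization of the matrix `A`: `dim h = 2n − rank A`, the
families `α` (in `h*`) and `Hv` (in `h`) are linearly independent, and
`α i (Hv j) = A j i`. -/
def IsRealization (A : Matrix I I k) (α : I → (h →ₗ[k] k)) (Hv : I → h) : Prop :=
  Module.finrank k h = 2 * Fintype.card I - A.rank ∧
  LinearIndependent k α ∧ LinearIndependent k Hv ∧
  ∀ i j, α i (Hv j) = A j i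

/-- `h'_J = span { Hv j : j ∈ J }`. -/
def hspan (Hv : I → h) (J : Finset I) : Submodule k h :=
  Submodule.span k (Hv '' ↑J)

/-- `t_J = ⋂_{j ∈ J} ker (α j)`. -/
def tcap (α : I → (h →ₗ[k] k)) (J : Finset I) : Submodule k h :=
  ⨅ j ∈ J, LinearMap.ker (α j)

/-- The submatrix `A_J`. -/
def subMat (A : Matrix I I k) (J : Finset I) : Matrix ↥J ↥J k :=
  A.submatrix Subtype.val Subtype.val

/-- Since `α` is linearly independent, `tcap α J` has codimension the cardinality of `J`. -/
theorem finrank_tcap_add_card {k I h : Type*} [Field k] [AddCommGroup h] [Module k h]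
    [FiniteDimensional k h] {α : I → (h →ₗ[k] k)} (hα : LinearIndependent k α) (J : Finset I) :
    Module.finrank k (tcap α J) + J.card = Module.finrank k h := by
  let W : Subspace k (Module.Dual k h) := Submodule.span k (Set.range fun j : J => α j)
  have hW : Module.finrank k W = J.card := by
    have hli : LinearIndependent k fun j : J => α j := hα.comp _ Subtype.val_injective
    simpa using finrank_span_eq_card hli
  have ht : tcap α J = W.dualCoannihilator := by
    ext x
    rw [Submodule.mem_dualCoannihilator]
    simp only [tcap, Submodule.mem_iInf, LinearMap.mem_ker]
    refine ⟨fun hx φ hφ => ?_, fun hx j hj => hx _ (Submodule.subset_span ⟨⟨j, hj⟩, rfl⟩)⟩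
    induction hφ using Submodule.span_induction with
    | mem φ hφ => obtain ⟨j, rfl⟩ := hφ; exact hx j j.2
    | zero => rfl
    | add φ ψ _ _ h₁ h₂ => simp [h₁, h₂]
    | smul a φ _ h₁ => simp [h₁]
  have := Subspace.finrank_add_finrank_dualCoannihilator_eq W
  rw [ht]
  omega

/-- A linear map `f` sends a subspace `S` onto a space of dimension
`dim (S + ker f) - dim (ker f)`. -/
theorem finrank_map_add_finrank_ker {k V W : Type*} [Field k] [AddCommGroup V] [Module k V]
    [FiniteDimensional k V] [AddCommGroup W] [Module k W] (f : V →ₗ[k] W) (S : Submodule k V) :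
    Module.finrank k (S.map f) + Module.finrank k (LinearMap.ker f) =
      Module.finrank k ↥(S ⊔ LinearMap.ker f) := by
  have hrank := (f.domRestrict (S ⊔ LinearMap.ker f)).finrank_range_add_finrank_ker
  have hmap : LinearMap.range (f.domRestrict (S ⊔ LinearMap.ker f)) = S.map f := by
    rw [LinearMap.range_domRestrict, Submodule.map_sup, sup_eq_left]
    rintro _ ⟨x, hx, rfl⟩
    rw [LinearMap.mem_ker.mp hx]
    exact zero_mem _
  have hker : Module.finrank k (LinearMap.ker (f.domRestrict (S ⊔ LinearMap.ker f))) =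
      Module.finrank k (LinearMap.ker f) := by
    rw [LinearMap.ker_domRestrict]
    exact (Submodule.comapSubtypeEquivOfLe le_sup_right).finrank_eq
  rwa [hmap, hker] at hrank

/-- If `α i (Hv j) = A j i` then `hspan Hv J + tcap α J` has dimension
`rank A_J + dim (tcap α J)`. -/
theorem finrank_hspan_sup_tcap {k I h : Type*} [Field k] [AddCommGroup h] [Module k h]
    [FiniteDimensional k h] {A : Matrix I I k} {α : I → (h →ₗ[k] k)} {Hv : I → h}
    (hA : ∀ i j, α i (Hv j) = A j i) (J : Finset I) :
    Module.finrank k ↥(hspan Hv J ⊔ tcap α J) =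
      (subMat A J).rank + Module.finrank k (tcap α J) := by
  let f : h →ₗ[k] (J → k) := LinearMap.pi fun j => α j
  have hker : tcap α J = LinearMap.ker f := by
    ext x
    simp [tcap, f, LinearMap.mem_ker, funext_iff]
  have hmap : (hspan Hv J).map f = Submodule.span k (Set.range (subMat A J).row) := by
    rw [hspan, Submodule.map_span, Set.image_image, Set.image_eq_range]
    congr 2
    ext j i
    exact hA i j
  rw [hker, ← finrank_map_add_finrank_ker, hmap, Matrix.rank_eq_finrank_span_row]

/-- A complement of `hspan Hv J + tcap α J` has dimension `corank A_J`. -/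
theorem finrank_compl_add_rank {k I h : Type*} [Field k] [AddCommGroup h] [Module k h]
    [FiniteDimensional k h] {A : Matrix I I k} {α : I → (h →ₗ[k] k)} {Hv : I → h}
    (hα : LinearIndependent k α) (hA : ∀ i j, α i (Hv j) = A j i) {J : Finset I}
    {c : Submodule k h} (hc : IsCompl c (hspan Hv J ⊔ tcap α J)) :
    Module.finrank k c + (subMat A J).rank = J.card := by
  have h₁ := Submodule.finrank_add_eq_of_isCompl hc
  have h₂ := finrank_tcap_add_card hα J
  rw [finrank_hspan_sup_tcap hA] at h₁
  omega

/-- Since `Hv` is linearly independent, `hspan Hv J` has dimension the cardinality of `J`. -/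
theorem finrank_hspan {k I h : Type*} [Field k] [AddCommGroup h] [Module k h]
    {Hv : I → h} (hHv : LinearIndependent k Hv) (J : Finset I) :
    Module.finrank k (hspan (k := k) Hv J) = J.card := by
  have hli : LinearIndependent k fun j : J => Hv j := hHv.comp _ Subtype.val_injective
  rw [hspan, Set.image_eq_range]
  exact (finrank_span_eq_card hli).trans (Fintype.card_coe J)

/-- If `c` is a complement of `hspan Hv J + tcap α J` then `hspan Hv J + c` has dimension
`card J + dim c`. -/
theorem finrank_hspan_sup_compl {k I h : Type*} [Field k] [AddCommGroup h] [Module k h]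
    [FiniteDimensional k h] {α : I → (h →ₗ[k] k)} {Hv : I → h} (hHv : LinearIndependent k Hv)
    {J : Finset I} {c : Submodule k h} (hc : IsCompl c (hspan Hv J ⊔ tcap α J)) :
    Module.finrank k ↥(hspan Hv J ⊔ c) = J.card + Module.finrank k c := by
  have hd : Disjoint (hspan Hv J) c := (hc.disjoint.mono_right le_sup_left).symm
  have := Submodule.finrank_sup_add_finrank_inf_eq (hspan Hv J) c
  rwa [hd.eq_bot, finrank_bot, add_zero, finrank_hspan hHv] at this

/-- if subspaces `h_{J'}`, `h_{J''}`, `h_{J'∩J''}` (of the standard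
form `h'_J ⊕ h''_J`) are chosen with `h_{J'∩J''} ⊆ h_{J'} ∩ h_{J''}`, then
`corank A_{J'∩J''} ≤ corank A_{J'} + corank A_{J''}`; in particular if the two
coranks vanish so does the third. -/
theorem corank_inequality [FiniteDimensional k h]
    (A : Matrix I I k) (α : I → (h →ₗ[k] k)) (Hv : I → h)
    (hreal : IsRealization A α Hv)
    (J₁ J₂ : Finset I) (hJ₁ : J₁.Nonempty) (hJ₂ : J₂.Nonempty)
    (hJ₁₂ : (J₁ ∩ J₂).Nonempty)
    (c₁ c₂ c₁₂ : Submodule k h)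
    (hc₁ : IsCompl c₁ (hspan Hv J₁ ⊔ tcap α J₁))
    (hc₂ : IsCompl c₂ (hspan Hv J₂ ⊔ tcap α J₂))
    (hc₁₂ : IsCompl c₁₂ (hspan Hv (J₁ ∩ J₂) ⊔ tcap α (J₁ ∩ J₂)))
    (hsub : hspan Hv (J₁ ∩ J₂) ⊔ c₁₂ ≤ (hspan Hv J₁ ⊔ c₁) ⊓ (hspan Hv J₂ ⊔ c₂)) :
    (J₁ ∩ J₂).card - (subMat A (J₁ ∩ J₂)).rank ≤
      (J₁.card - (subMat A J₁).rank) + (J₂.card - (subMat A J₂).rank) ∧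
    ((subMat A J₁).rank = J₁.card → (subMat A J₂).rank = J₂.card →
      (subMat A (J₁ ∩ J₂)).rank = (J₁ ∩ J₂).card) := by
  obtain ⟨-, hα, hHv, hA⟩ := hreal
  have r₁ := finrank_compl_add_rank hα hA hc₁
  have r₂ := finrank_compl_add_rank hα hA hc₂
  have r₁₂ := finrank_compl_add_rank hα hA hc₁₂
  have d₁ := finrank_hspan_sup_compl hHv hc₁
  have d₂ := finrank_hspan_sup_compl hHv hc₂
  have d₁₂ := finrank_hspan_sup_compl hHv hc₁₂
  have hle := Submodule.finrank_mono hsub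
  have hsum := Submodule.finrank_sup_add_finrank_inf_eq (hspan Hv J₁ ⊔ c₁) (hspan Hv J₂ ⊔ c₂)
  have hunion : hspan Hv (J₁ ∪ J₂) ≤ (hspan Hv J₁ ⊔ c₁) ⊔ (hspan Hv J₂ ⊔ c₂) := by
    rw [hspan, Finset.coe_union, Set.image_union, Submodule.span_union]
    exact sup_le_sup le_sup_left le_sup_left
  have hu := Submodule.finrank_mono hunion
  rw [finrank_hspan hHv] at hu
  have hcard := Finset.card_union_add_card_inter J₁ J₂
  omega

end RealizationStmt
end

section
/- Let A be the symmetric 4×4 matrix with rows (2,−2,0,0), (−2,2,−1,0), (0,−1,2,−1), (0,0,−1,2) over a field k of characteristic zero. Then (1) for all nonempty J′, J″ ⊆ {1,2,3,4} with nonempty intersection, corank(A_{J′∩J″}) ≤ corank(A_{J′}) + corank(A_{J″}); yet (2) for any realization (h, (α_i), (h_i)) of A, there is no choice of subspaces h''_J (a complement of h'_J + t_J in h) for every nonempty J ⊆ {1,2,3,4} such that the subspaces h_J := h'_J ⊕ h''_J satisfy both h_J ⊆ h_{J′} whenever J ⊆ J′ and h_J ⊆ t_{J^⊥} for every J. (Indeed,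 such a choice would force the one-dimensional space h''_{{1,2}} to lie in h_{{1,2,3}} ∩ ker α₄ = span{h₁, h₂} = h'_{{1,2}}, contradicting h''_{{1,2}} ∩ h'_{{1,2}} = 0.) -/
namespace RealizationStmt

variable {k : Type*} [Field k] [CharZero k]
variable {I : Type*} [Fintype I] [DecidableEq I]
variable {h : Type*} [AddCommGroup h] [Module k h]

open scoped Classical in
/-- `J^⊥ = { i ∉ J : A i j = 0 and A j i = 0 for all j ∈ J }`. -/
noncomputable def perpIdx (A : Matrix I I k) (J : Finset I) : Finset I :=
  Finset.univ.filter fun i => i ∉ J ∧ ∀ j ∈ J, A i j = 0 ∧ A j i = 0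

/-- The matrix with rows `(2,−2,0,0), (−2,2,−1,0), (0,−1,2,−1), (0,0,−1,2)`. -/
def mat18 (k : Type*) [Field k] : Matrix (Fin 4) (Fin 4) k :=
  !![2, -2, 0, 0; -2, 2, -1, 0; 0, -1, 2, -1; 0, 0, -1, 2]

universe u

/-- Vectors supported on `J` which `A` maps to vectors vanishing on `J`: the kernel of `A_J`,
extended by zero. -/
def extendedKer (A : Matrix I I k) (J : Finset I) : Submodule k (I → k) where
  carrier := {v | (∀ i ∉ J, v i = 0) ∧ ∀ i ∈ J, A.mulVec v i = 0}
  add_mem' := fun ha hb =>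
    ⟨fun i hi => by simp [ha.1 i hi, hb.1 i hi],
      fun i hi => by simp [Matrix.mulVec_add, ha.2 i hi, hb.2 i hi]⟩
  zero_mem' := by simp
  smul_mem' := fun c v hv =>
    ⟨fun i hi => by simp [hv.1 i hi], fun i hi => by simp [Matrix.mulVec_smul, hv.2 i hi]⟩

omit [CharZero k] [DecidableEq I] in
lemma mem_extendedKer {A : Matrix I I k} {J : Finset I} {v : I → k} :
    v ∈ extendedKer A J ↔ (∀ i ∉ J, v i = 0) ∧ ∀ i ∈ J, A.mulVec v i = 0 := Iff.rfl

omit [CharZero k] [DecidableEq I] in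
lemma subMat_mulVec_restrict (A : Matrix I I k) {J : Finset I} {v : I → k}
    (hv : ∀ i ∉ J, v i = 0) (i : J) :
    (subMat A J).mulVec (fun j => v j) i = A.mulVec v i := by
  simp only [Matrix.mulVec, dotProduct, subMat, Matrix.submatrix_apply]
  rw [Finset.sum_coe_sort J (fun j => A i j * v j)]
  exact Finset.sum_subset (Finset.subset_univ J) fun j _ hj => by simp [hv j hj]

omit [CharZero k] in
lemma card_sub_rank_subMat (A : Matrix I I k) (J : Finset I) :
    J.card - (subMat A J).rank = Module.finrank k (extendedKer A J) := by
  have hrank := LinearMap.finrank_range_add_finrank_ker (subMat A J).mulVecLin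
  rw [Module.finrank_fintype_fun_eq_card, Fintype.card_coe] at hrank
  have hker : Module.finrank k (LinearMap.ker (subMat A J).mulVecLin) =
      Module.finrank k (extendedKer A J) := by
    let r : extendedKer A J →ₗ[k] LinearMap.ker (subMat A J).mulVecLin :=
      { toFun := fun v => ⟨fun j => v.1 j, by
          rw [LinearMap.mem_ker, Matrix.mulVecLin_apply]
          ext i
          rw [subMat_mulVec_restrict A v.2.1]
          exact v.2.2 i i.2⟩
        map_add' := fun _ _ => rfl
        map_smul' := fun _ _ => rfl }
    refine (LinearEquiv.ofBijective r ⟨fun v w hvw => ?_, fun w => ?_⟩).finrank_eq.symm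
    · ext i
      by_cases hi : i ∈ J
      · exact congrFun (congrArg Subtype.val hvw) ⟨i, hi⟩
      · rw [v.2.1 i hi, w.2.1 i hi]
    · have hsupp : ∀ i ∉ J, (fun i => if hi : i ∈ J then w.1 ⟨i, hi⟩ else 0) i = 0 :=
        fun i hi => dif_neg hi
      have hres : (fun j : J => (fun i => if hi : i ∈ J then w.1 ⟨i, hi⟩ else 0) j.1) = w.1 := by
        ext j
        simp
      refine ⟨⟨_, hsupp, fun i hi => ?_⟩, Subtype.ext hres⟩
      have key := subMat_mulVec_restrict A hsupp ⟨i, hi⟩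
      rw [hres] at key
      rw [← key]
      exact congrFun (LinearMap.mem_ker.1 w.2) ⟨i, hi⟩
  unfold Matrix.rank
  omega

omit [CharZero k] in
lemma mat18_mulVec (v : Fin 4 → k) :
    (mat18 k).mulVec v = ![2 * v 0 - 2 * v 1, -2 * v 0 + 2 * v 1 - v 2,
      -v 1 + 2 * v 2 - v 3, -v 2 + 2 * v 3] := by
  ext i
  fin_cases i <;> simp [mat18, Matrix.mulVec, dotProduct, Fin.sum_univ_four] <;> ring

lemma eq_of_mem_extendedKer_mat18 {J : Finset (Fin 4)} {v : Fin 4 → k}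
    (hv : v ∈ extendedKer (mat18 k) J) : v 0 = v 1 ∧ v 2 = 0 ∧ v 3 = 0 := by
  have hprod : ∀ i, v i = 0 ∨ (mat18 k).mulVec v i = 0 := fun i => by
    by_cases hi : i ∈ J
    exacts [Or.inr (hv.2 i hi), Or.inl (hv.1 i hi)]
  have h0 := hprod 0
  have h1 := hprod 1
  have h2 := hprod 2
  have h3 := hprod 3
  simp only [mat18_mulVec, Matrix.cons_val] at h0 h1 h2 h3
  rcases h0 with h0 | h0 <;> rcases h1 with h1 | h1 <;> rcases h2 with h2 | h2 <;>
    rcases h3 with h3 | h3 <;> grind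

lemma extendedKer_mat18_mono {J K : Finset (Fin 4)} (hJK : J ⊆ K) (hK : 2 ∉ K) :
    extendedKer (mat18 k) J ≤ extendedKer (mat18 k) K := by
  intro v hv
  obtain ⟨h01, h2, h3⟩ := eq_of_mem_extendedKer_mat18 hv
  refine ⟨fun i hi => hv.1 i fun h => hi (hJK h), fun i hi => ?_⟩
  have hi2 : i ≠ 2 := fun h => hK (h ▸ hi)
  rw [mat18_mulVec]
  fin_cases i <;> simp_all

lemma extendedKer_mat18_eq_bot {J : Finset (Fin 4)} (hJ : 2 ∈ J) :
    extendedKer (mat18 k) J = ⊥ := by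
  rw [Submodule.eq_bot_iff]
  intro v hv
  obtain ⟨h01, h2, h3⟩ := eq_of_mem_extendedKer_mat18 hv
  have h := hv.2 2 hJ
  rw [mat18_mulVec] at h
  ext i
  fin_cases i <;> simp_all

lemma corank_subMat_mat18_inter_le (J₁ J₂ : Finset (Fin 4)) :
    (J₁ ∩ J₂).card - (subMat (mat18 k) (J₁ ∩ J₂)).rank ≤
      (J₁.card - (subMat (mat18 k) J₁).rank) + (J₂.card - (subMat (mat18 k) J₂).rank) := by
  simp only [card_sub_rank_subMat]
  by_cases h₁ : 2 ∈ J₁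
  · by_cases h₂ : 2 ∈ J₂
    · rw [extendedKer_mat18_eq_bot (Finset.mem_inter.2 ⟨h₁, h₂⟩), finrank_bot]
      exact Nat.zero_le _
    · exact (Submodule.finrank_mono (extendedKer_mat18_mono Finset.inter_subset_right h₂)).trans
        (Nat.le_add_left _ _)
  · exact (Submodule.finrank_mono (extendedKer_mat18_mono Finset.inter_subset_left h₁)).trans
      (Nat.le_add_right _ _)

omit [CharZero k] in
lemma mem_perpIdx {A : Matrix I I k} {J : Finset I} {i : I} :
    i ∈ perpIdx A J ↔ i ∉ J ∧ ∀ j ∈ J, A i j = 0 ∧ A j i = 0 := by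
  simp [perpIdx]

omit [CharZero k] [Fintype I] [DecidableEq I] in
lemma mem_tcap {α : I → (h →ₗ[k] k)} {J : Finset I} {x : h} :
    x ∈ tcap α J ↔ ∀ j ∈ J, α j x = 0 := by
  simp [tcap]

lemma hspan_sup_tcap_eq_top {α : Fin 4 → (h →ₗ[k] k)} {Hv : Fin 4 → h}
    (hα : ∀ i j, α i (Hv j) = mat18 k j i) :
    hspan Hv {0, 1, 2} ⊔ tcap α {0, 1, 2} = ⊤ := by
  rw [eq_top_iff]
  intro x _
  set c := -(α 0 x + α 1 x)
  set b := 2 * c - α 2 x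
  set a := b + α 0 x / 2
  have hy : a • Hv 0 + b • Hv 1 + c • Hv 2 ∈ hspan Hv {0, 1, 2} :=
    add_mem (add_mem (Submodule.smul_mem _ _ (Submodule.subset_span ⟨0, by simp, rfl⟩))
      (Submodule.smul_mem _ _ (Submodule.subset_span ⟨1, by simp, rfl⟩)))
      (Submodule.smul_mem _ _ (Submodule.subset_span ⟨2, by simp, rfl⟩))
  refine Submodule.mem_sup.2 ⟨_, hy, x - (a • Hv 0 + b • Hv 1 + c • Hv 2), ?_,
    add_sub_cancel _ _⟩
  rw [mem_tcap]
  intro j hj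
  simp only [Finset.mem_insert, Finset.mem_singleton] at hj
  rcases hj with rfl | rfl | rfl <;>
    simp [hα, mat18, a, b, c] <;> field_simp <;> ring

omit [CharZero k] in
lemma hspan_inf_ker_le {α : Fin 4 → (h →ₗ[k] k)} {Hv : Fin 4 → h}
    (hα : ∀ i j, α i (Hv j) = mat18 k j i) :
    hspan Hv {0, 1, 2} ⊓ LinearMap.ker (α 3) ≤ hspan Hv {0, 1} := by
  rintro x ⟨hx, hx3⟩
  simp only [hspan, Finset.coe_insert, Finset.coe_singleton, Set.image_insert_eq,
    Set.image_singleton, SetLike.mem_coe, Submodule.mem_span_triple] at hx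
  obtain ⟨a, b, c, rfl⟩ := hx
  have hc : c = 0 := by simpa [hα, mat18] using hx3
  simp only [hspan, Finset.coe_insert, Finset.coe_singleton, Set.image_insert_eq,
    Set.image_singleton, Submodule.mem_span_pair]
  exact ⟨a, b, by simp [hc]⟩

omit [CharZero k] in
lemma hspan_sup_tcap_ne_top {α : Fin 4 → (h →ₗ[k] k)} {Hv : Fin 4 → h}
    (hli : LinearIndependent k α) (hα : ∀ i j, α i (Hv j) = mat18 k j i) :
    hspan Hv {0, 1} ⊔ tcap α {0, 1} ≠ ⊤ := by
  intro htop
  have hle : hspan Hv {0, 1} ⊔ tcap α {0, 1} ≤ LinearMap.ker (α 0 + α 1) := by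
    refine sup_le (Submodule.span_le.2 ?_) fun x hx => ?_
    · rintro _ ⟨j, hj, rfl⟩
      simp only [Finset.coe_insert, Finset.coe_singleton, Set.mem_insert_iff,
        Set.mem_singleton_iff] at hj
      rcases hj with rfl | rfl <;> simp [hα, mat18]
    · rw [mem_tcap] at hx
      simp [hx 0 (by simp), hx 1 (by simp)]
  have hzero : α 0 + α 1 = 0 := LinearMap.ker_eq_top.1 (top_le_iff.1 (htop ▸ hle))
  have h1 := Fintype.linearIndependent_iff.1 hli ![1, 1, 0, 0]
    (by simpa [Fin.sum_univ_four] using hzero) 0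
  simp at h1

/-- the matrix `mat18` satisfies the corank condition
`corank A_{J'∩J''} ≤ corank A_{J'} + corank A_{J''}` for all nonempty `J', J''`
with nonempty intersection, yet for any realization of it there is no choice of
the subspaces `h_J = h'_J ⊕ h''_J` which is both monotone and satisfies
`h_J ⊆ t_{J^⊥}` for every `J`. -/
theorem corank_condition_insufficient (k : Type*) [Field k] [CharZero k] :
    (∀ J₁ J₂ : Finset (Fin 4), J₁.Nonempty → J₂.Nonempty → (J₁ ∩ J₂).Nonempty →
      (J₁ ∩ J₂).card - (subMat (mat18 k) (J₁ ∩ J₂)).rank ≤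
        (J₁.card - (subMat (mat18 k) J₁).rank) +
          (J₂.card - (subMat (mat18 k) J₂).rank)) ∧
    (∀ (h : Type u) [AddCommGroup h] [Module k h] [FiniteDimensional k h],
      ∀ (α : Fin 4 → (h →ₗ[k] k)) (Hv : Fin 4 → h),
        IsRealization (mat18 k) α Hv →
        ¬ ∃ c : Finset (Fin 4) → Submodule k h,
            (∀ J : Finset (Fin 4), J.Nonempty →
              IsCompl (c J) (hspan Hv J ⊔ tcap α J)) ∧
            (∀ J J' : Finset (Fin 4), J.Nonempty → J ⊆ J' →
              hspan Hv J ⊔ c J ≤ hspan Hv J' ⊔ c J') ∧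
            (∀ J : Finset (Fin 4), J.Nonempty →
              hspan Hv J ⊔ c J ≤ tcap α (perpIdx (mat18 k) J))) := by
  refine ⟨fun J₁ J₂ _ _ _ => corank_subMat_mat18_inter_le J₁ J₂, ?_⟩
  rintro h _ _ _ α Hv ⟨-, hli, -, hα⟩ ⟨c, hcompl, hmono, hperp⟩
  have hbot : c {0, 1, 2} = ⊥ := by
    have h012 := hcompl {0, 1, 2} (by simp)
    rw [hspan_sup_tcap_eq_top hα] at h012
    simpa using h012.inf_eq_bot
  have hle : c {0, 1} ≤ hspan Hv {0, 1} := by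
    refine le_trans (le_inf ?_ ?_) (hspan_inf_ker_le hα)
    · have h012 := hmono {0, 1} {0, 1, 2} (by simp) (by decide)
      rw [hbot, sup_bot_eq] at h012
      exact le_sup_right.trans h012
    · refine fun x hx => mem_tcap.1 (hperp {0, 1} (by simp) (Submodule.mem_sup_right hx)) 3 ?_
      simp [mem_perpIdx, mat18]
  have h01 := hcompl {0, 1} (by simp)
  refine hspan_sup_tcap_ne_top hli hα ?_
  rw [← h01.sup_eq_top, eq_comm, sup_eq_right]
  exact hle.trans le_sup_left

end RealizationStmt
end
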